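/- Suppose $Z(t) = \sum_{k=0}^d t^{-\beta_k} G_k(\log(1/t)) + R(t)$ for $0 < t < 1$, where $\beta_0 > \beta_1 > \cdots > \beta_d \ge 0$, each $G_k$ is continuous, periodic with period $P_k > 0$ and bounded, and $|R(t)| \le C\exp(-ct^{-\alpha})$ with $c, \alpha > 0$; and $|Z(t)| \le c_5 e^{-c_6 t}$ for $t \ge 1$ with $c_6 > 0$. Then for each $\gamma > -c_6$, the function $s \mapsto \int_0^\infty t^{s-1} Z(t) e^{-\gamma t}\, dt$ extends meromorphically to all of $\mathbb{C}$, with poles contained in the set $\bigcup_{k=0}^d \{\beta_k - m + \frac{2\pi i n}{P_k} : m \in \mathbb{Z}_{\ge 0}, n \in \mathbb{Z}\}$. -/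

import Mathlib

open MeasureTheory Complex Set

lemma aux_locInt (f : ℝ → ℂ) (hf : Measurable f) (K : ℝ) (hK : ∀ t, 0 < t → ‖f t‖ ≤ K) :
    LocallyIntegrableOn f (Ioi (0:ℝ)) := by
  have h1 : LocallyIntegrableOn ((Ioi (0:ℝ)).indicator f) (Ioi (0:ℝ)) := by
    refine LocallyIntegrableOn.mono (f := fun _ : ℝ => K)
      ((locallyIntegrable_const K).locallyIntegrableOn _)
      (hf.indicator measurableSet_Ioi).aestronglyMeasurable (Filter.Eventually.of_forall fun t => ?_)
    have hK0 : 0 ≤ K := (norm_nonneg _).trans (hK 1 one_pos)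
    rw [Real.norm_of_nonneg hK0]
    by_cases ht : t ∈ Ioi (0:ℝ)
    · rw [indicator_of_mem ht]; exact hK t ht
    · rw [indicator_of_notMem ht]; simpa using hK0
  refine h1.congr ?_
  filter_upwards [ae_restrict_mem measurableSet_Ioi] with t ht
  rw [indicator_of_mem ht]

/-- The truncated log-periodic function. -/
noncomputable def auxF (G : ℝ → ℝ) (t : ℝ) : ℂ :=
  (Ioo (0:ℝ) 1).indicator (fun t => (G (Real.log (1 / t)) : ℂ)) t

lemma auxF_meas (G : ℝ → ℝ) (hG : Continuous G) : Measurable (auxF G) := by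
  unfold auxF
  refine Measurable.indicator ?_ measurableSet_Ioo
  exact Complex.measurable_ofReal.comp (hG.measurable.comp
    (Real.measurable_log.comp (measurable_const.div measurable_id)))

lemma auxF_bd (G : ℝ → ℝ) (M : ℝ) (hM : ∀ x, |G x| ≤ M) (t : ℝ) : ‖auxF G t‖ ≤ M := by
  have hM0 : 0 ≤ M := (abs_nonneg _).trans (hM 0)
  unfold auxF
  by_cases ht : t ∈ Ioo (0:ℝ) 1
  · rw [indicator_of_mem ht, Complex.norm_real]; exact hM _
  · rw [indicator_of_notMem ht]; simpa using hM0

lemma auxF_zero (G : ℝ → ℝ) (t : ℝ) (ht : 1 ≤ t) : auxF G t = 0 := by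
  unfold auxF
  rw [indicator_of_notMem]; intro h; exact absurd h.2 (not_lt.2 ht)

lemma aux_top (f : ℝ → ℂ) (hf : ∀ t, 1 ≤ t → f t = 0) (g : ℝ → ℝ) : f =O[Filter.atTop] g := by
  refine Filter.EventuallyEq.trans_isBigO (f₂ := fun _ => (0:ℂ)) ?_ (Asymptotics.isBigO_zero _ _)
  filter_upwards [Filter.eventually_ge_atTop (1:ℝ)] with t ht using hf t ht

lemma auxF_bot (G : ℝ → ℝ) (M : ℝ) (hM : ∀ x, |G x| ≤ M) :
    auxF G =O[nhdsWithin 0 (Ioi 0)] (fun t : ℝ => t ^ (-(0:ℝ))) := by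
  refine Asymptotics.IsBigO.of_bound M (Filter.Eventually.of_forall fun t => ?_)
  simpa using auxF_bd G M hM t

lemma auxF_conv (G : ℝ → ℝ) (hG : Continuous G) (M : ℝ) (hM : ∀ x, |G x| ≤ M) (w : ℂ)
    (hw : 0 < w.re) : MellinConvergent (auxF G) w :=
  mellinConvergent_of_isBigO_rpow
    (aux_locInt _ (auxF_meas G hG) M fun t _ => auxF_bd G M hM t)
    (aux_top _ (auxF_zero G) _) (lt_add_one _) (auxF_bot G M hM) hw

lemma auxF_diff (G : ℝ → ℝ) (hG : Continuous G) (M : ℝ) (hM : ∀ x, |G x| ≤ M) (w : ℂ)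
    (hw : 0 < w.re) : DifferentiableAt ℂ (mellin (auxF G)) w :=
  mellin_differentiableAt_of_isBigO_rpow
    (aux_locInt _ (auxF_meas G hG) M fun t _ => auxF_bd G M hM t)
    (aux_top _ (auxF_zero G) _) (lt_add_one _) (auxF_bot G M hM) hw

lemma auxF_mellin_bd (G : ℝ → ℝ) (M : ℝ) (hM : ∀ x, |G x| ≤ M) (w : ℂ)
    (hw : 1 < w.re) : ‖mellin (auxF G) w‖ ≤ M := by
  have hM0 : 0 ≤ M := (abs_nonneg _).trans (hM 0)
  have h1 : mellin (auxF G) w = ∫ t in Ioo (0:ℝ) 1, (t:ℂ) ^ (w - 1) • auxF G t := by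
    unfold mellin
    refine (setIntegral_eq_of_subset_of_forall_sdiff_eq_zero measurableSet_Ioi
      (fun t ht => ht.1) ?_)
    rintro t ⟨ht, ht2⟩
    rw [auxF_zero G t, smul_zero]
    by_contra h
    exact ht2 ⟨ht, not_le.1 h⟩
  rw [h1]
  have := norm_setIntegral_le_of_norm_le_const (μ := volume) (s := Ioo (0:ℝ) 1)
    (f := fun t : ℝ => (t:ℂ) ^ (w - 1) • auxF G t) (C := M) (by simp) (fun t ht => by
      rw [norm_smul, Complex.norm_cpow_eq_rpow_re_of_pos ht.1]
      have : t ^ (w - 1).re ≤ 1 := Real.rpow_le_one ht.1.le ht.2.le (by simp; linarith)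
      calc _ ≤ 1 * M := by gcongr; exact auxF_bd G M hM t
        _ = M := one_mul _)
  simpa using this

/-- The entire numerator. -/
noncomputable def auxE (G : ℝ → ℝ) (P : ℝ) : ℂ → ℂ :=
  mellin (fun t => auxF G t - auxF G (Real.exp P * t))

lemma auxE_van (G : ℝ → ℝ) (P : ℝ) (hper : Function.Periodic G P) (t : ℝ)
    (ht : 0 < t) (ht2 : t < Real.exp (-P)) (hP : 0 < P) :
    auxF G t - auxF G (Real.exp P * t) = 0 := by
  have h1 : Real.exp P * t < 1 := by
    have := mul_lt_mul_of_pos_left ht2 (Real.exp_pos P)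
    rwa [← Real.exp_add, add_neg_cancel, Real.exp_zero] at this
  have h2 : t < 1 := ht2.trans (by rw [Real.exp_lt_one_iff]; linarith)
  have h3 : 0 < Real.exp P * t := mul_pos (Real.exp_pos P) ht
  unfold auxF
  rw [indicator_of_mem (show t ∈ Ioo (0:ℝ) 1 from ⟨ht, h2⟩), indicator_of_mem (show _ ∈ Ioo (0:ℝ) 1 from ⟨h3, h1⟩)]
  have : Real.log (1 / t) = Real.log (1 / (Real.exp P * t)) + P := by
    rw [one_div, one_div, Real.log_inv, Real.log_inv, Real.log_mul (Real.exp_pos P).ne' ht.ne',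
      Real.log_exp]; ring
  rw [this, hper, sub_self]

lemma auxE_diff (G : ℝ → ℝ) (hG : Continuous G) (M : ℝ) (hM : ∀ x, |G x| ≤ M)
    (P : ℝ) (hP : 0 < P) (hper : Function.Periodic G P) : Differentiable ℂ (auxE G P) := by
  intro w
  refine mellin_differentiableAt_of_isBigO_rpow (a := w.re + 1) (b := w.re - 1)
    (aux_locInt _ ((auxF_meas G hG).sub
      ((auxF_meas G hG).comp (measurable_const.mul measurable_id))) (M + M) fun t _ => ?_)
    (aux_top _ (fun t ht => ?_) _) (lt_add_one _) ?_ (sub_one_lt _)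
  · exact (norm_sub_le _ _).trans (add_le_add (auxF_bd G M hM _) (auxF_bd G M hM _))
  · rw [auxF_zero G t ht, auxF_zero, sub_zero]
    have := Real.one_le_exp hP.le
    nlinarith
  · refine Filter.EventuallyEq.trans_isBigO (f₂ := fun _ => (0:ℂ)) ?_ (Asymptotics.isBigO_zero _ _)
    filter_upwards [Ioo_mem_nhdsGT (Real.exp_pos (-P))] with t ht
    exact auxE_van G P hper t ht.1 ht.2 hP

lemma auxE_eq (G : ℝ → ℝ) (hG : Continuous G) (M : ℝ) (hM : ∀ x, |G x| ≤ M)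
    (P : ℝ) (w : ℂ) (hw : 0 < w.re) :
    auxE G P w = (1 - Complex.exp (-(P * w))) * mellin (auxF G) w := by
  have hc := auxF_conv G hG M hM w hw
  have := (hasMellin_sub hc ((MellinConvergent.comp_mul_left (Real.exp_pos P)).2 hc)).2
  unfold auxE
  rw [this, mellin_comp_mul_left _ _ (Real.exp_pos P), Complex.ofReal_exp,
    Complex.cpow_def_of_ne_zero (Complex.exp_ne_zero _), ← Complex.ofReal_exp,
    ← Complex.ofReal_log (Real.exp_pos P).le, Real.log_exp, smul_eq_mul]
  ring_nf

/-- Meromorphic continuation of the Mellin transform of `auxF`. -/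
noncomputable def auxL (G : ℝ → ℝ) (P : ℝ) (w : ℂ) : ℂ :=
  auxE G P w / (1 - Complex.exp (-(P * w)))

lemma auxL_eq (G : ℝ → ℝ) (hG : Continuous G) (M : ℝ) (hM : ∀ x, |G x| ≤ M)
    (P : ℝ) (hP : 0 < P) (w : ℂ) (hw : 0 < w.re) : auxL G P w = mellin (auxF G) w := by
  have h : (1 - Complex.exp (-(P * w))) ≠ 0 := by
    intro h
    have h2 : ‖Complex.exp (-(P * w))‖ = 1 := by rw [← sub_eq_zero.1 h]; simp
    rw [Complex.norm_exp, Real.exp_eq_one_iff] at h2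
    simp at h2
    rcases h2 with h2 | h2 <;> linarith
  unfold auxL
  rw [auxE_eq G hG M hM P w hw, mul_div_cancel_left₀ _ h]

lemma auxL_ana (G : ℝ → ℝ) (hG : Continuous G) (M : ℝ) (hM : ∀ x, |G x| ≤ M)
    (P : ℝ) (hP : 0 < P) (hper : Function.Periodic G P) (w : ℂ) :
    MeromorphicAt (auxL G P) w ∧ ((1 - Complex.exp (-(P * w))) ≠ 0 → AnalyticAt ℂ (auxL G P) w) := by
  have h1 : AnalyticAt ℂ (auxE G P) w := (auxE_diff G hG M hM P hP hper).analyticAt w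
  have h2 : AnalyticAt ℂ (fun w : ℂ => 1 - Complex.exp (-(P * w))) w := by fun_prop
  exact ⟨h1.meromorphicAt.div h2.meromorphicAt, fun h => h1.div h2 h⟩

lemma auxL_pole (P : ℝ) (hP : 0 < P) (w : ℂ) (h : (1 - Complex.exp (-(P * w))) = 0) :
    ∃ n : ℤ, w = 2 * Real.pi * Complex.I * n / P := by
  obtain ⟨n, hn⟩ := Complex.exp_eq_one_iff.1 (sub_eq_zero.1 h).symm
  refine ⟨-n, ?_⟩
  have : (P:ℂ) ≠ 0 := by exact_mod_cast hP.ne'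
  field_simp
  push_cast
  linear_combination -hn

/-- Sum of shifted continuations. -/
noncomputable def auxS (G : ℝ → ℝ) (P γ : ℝ) (w : ℂ) : ℂ :=
  ∑' m : ℕ, ((-γ : ℂ) ^ m / (m.factorial : ℂ)) * auxL G P (w + m)

lemma auxS_mellin (G : ℝ → ℝ) (hG : Continuous G) (M : ℝ) (hM : ∀ x, |G x| ≤ M)
    (P γ : ℝ) (hP : 0 < P) (w : ℂ) (hw : 0 < w.re) :
    MellinConvergent (fun t => auxF G t * (Real.exp (-γ * t) : ℂ)) w ∧
    auxS G P γ w = mellin (fun t => auxF G t * (Real.exp (-γ * t) : ℂ)) w := by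
  have hc := auxF_conv G hG M hM w hw
  set Φ : ℝ → ℂ := fun t => (t:ℂ) ^ (w - 1) • auxF G t with hΦ
  have hΦi : Integrable Φ (volume.restrict (Ioi 0)) := hc
  constructor
  · have : Integrable (fun t : ℝ => Real.exp |γ| * ‖Φ t‖) (volume.restrict (Ioi 0)) :=
      hΦi.norm.const_mul _
    refine Integrable.mono (f := fun t : ℝ => (t:ℂ) ^ (w - 1) • (auxF G t * (Real.exp (-γ * t) : ℂ)))
      this ?_ ?_
    · have : (fun t : ℝ => (t:ℂ) ^ (w - 1) • (auxF G t * (Real.exp (-γ * t) : ℂ))) =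
          fun t => Φ t * (Real.exp (-γ * t) : ℂ) := by
        ext t; simp only [hΦ, smul_eq_mul]; ring
      rw [this]
      refine hΦi.aestronglyMeasurable.mul (Continuous.aestronglyMeasurable (by fun_prop))
    · filter_upwards [ae_restrict_mem measurableSet_Ioi] with t ht
      by_cases h1 : 1 ≤ t
      · simp [hΦ, auxF_zero G t h1]
      · have h2 : Real.exp (-γ * t) ≤ Real.exp |γ| := by
          apply Real.exp_le_exp.2
          have h0 : (0:ℝ) < t := ht
          push Not at h1
          nlinarith [neg_abs_le γ, abs_nonneg γ]
        simp only [hΦ, smul_eq_mul, norm_mul, Complex.norm_real, norm_norm,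
          Real.norm_of_nonneg (Real.exp_pos _).le]
        calc _ = Real.exp (-γ * t) * (‖(t:ℂ) ^ (w - 1)‖ * ‖auxF G t‖) := by ring
          _ ≤ _ := by gcongr
  · set F : ℕ → ℝ → ℂ := fun m t => ((-γ : ℂ) ^ m / (m.factorial : ℂ) * (t:ℂ) ^ m) * Φ t with hF
    have hbd : ∀ m, ∀ t ∈ Ioi (0:ℝ), ‖F m t‖ ≤ (|γ| ^ m / m.factorial) * ‖Φ t‖ := by
      intro m t ht
      by_cases h1 : 1 ≤ t
      · simp [hF, hΦ, auxF_zero G t h1]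
      · push Not at h1
        simp only [hF, norm_mul, norm_div, norm_pow, norm_neg, Complex.norm_real,
          Complex.norm_natCast, Real.norm_eq_abs]
        have : |t| ^ m ≤ 1 := pow_le_one₀ (abs_nonneg _) (by rw [abs_of_pos ht]; exact h1.le)
        have h3 : 0 ≤ |γ| ^ m / m.factorial := by positivity
        calc _ ≤ |γ| ^ m / m.factorial * 1 * ‖Φ t‖ := by gcongr
          _ = _ := by ring
    have hFi : ∀ m, Integrable (F m) (volume.restrict (Ioi 0)) := by
      intro m
      refine Integrable.mono' (hΦi.norm.const_mul (|γ| ^ m / m.factorial)) ?_ ?_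
      · exact (Continuous.aestronglyMeasurable (by fun_prop)).mul hΦi.aestronglyMeasurable
      · filter_upwards [ae_restrict_mem measurableSet_Ioi] with t ht using hbd m t ht
    have hsum : Summable fun m => ∫ t in Ioi (0:ℝ), ‖F m t‖ := by
      refine Summable.of_nonneg_of_le (fun m => integral_nonneg fun t => norm_nonneg _) (fun m => ?_)
        ((Real.summable_pow_div_factorial |γ|).mul_right (∫ t in Ioi (0:ℝ), ‖Φ t‖))
      rw [← integral_const_mul]
      exact setIntegral_mono_on (hFi m).norm (hΦi.norm.const_mul _) measurableSet_Ioi (hbd m)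
    have key := integral_tsum_of_summable_integral_norm hFi hsum
    have e1 : ∀ m : ℕ, ∫ t in Ioi (0:ℝ), F m t =
        ((-γ : ℂ) ^ m / (m.factorial : ℂ)) * auxL G P (w + m) := by
      intro m
      rw [auxL_eq G hG M hM P hP (w + m) (by simp; positivity), mellin, ← integral_const_mul]
      refine setIntegral_congr_fun measurableSet_Ioi fun t ht => ?_
      have h0 : (t:ℂ) ≠ 0 := by exact_mod_cast (ne_of_gt ht)
      simp only [hF, hΦ, smul_eq_mul]
      rw [show w + m - 1 = (w - 1) + m by ring, Complex.cpow_add _ _ h0, Complex.cpow_natCast]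
      ring
    unfold auxS
    simp_rw [← e1]
    rw [key, mellin]
    refine setIntegral_congr_fun measurableSet_Ioi fun t ht => ?_
    simp only [hF, hΦ]
    rw [tsum_mul_right]
    have : ∑' m : ℕ, (-γ : ℂ) ^ m / (m.factorial : ℂ) * (t:ℂ) ^ m = (Real.exp (-γ * t) : ℂ) := by
      rw [Complex.ofReal_exp, Complex.exp_eq_exp_ℂ, NormedSpace.exp_eq_tsum_div]
      congr 1; ext m; push_cast; rw [mul_pow]; ring
    rw [this]; simp only [smul_eq_mul]; ring

lemma auxS_mero (G : ℝ → ℝ) (hG : Continuous G) (M : ℝ) (hM : ∀ x, |G x| ≤ M)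
    (P γ : ℝ) (hP : 0 < P) (hper : Function.Periodic G P) (w : ℂ) :
    MeromorphicAt (auxS G P γ) w ∧ (¬ AnalyticAt ℂ (auxS G P γ) w →
      ∃ (m : ℕ) (n : ℤ), w = - m + 2 * Real.pi * Complex.I * n / P) := by
  obtain ⟨N, hN⟩ := exists_nat_gt (1 - w.re)
  set U : Set ℂ := {z | 1 - (N:ℝ) < z.re} with hU
  have hUo : IsOpen U := isOpen_lt continuous_const Complex.continuous_re
  have hwU : w ∈ U := by simp only [hU, mem_ofPred_eq]; linarith
  set T : ℕ → ℂ → ℂ := fun m z => ((-γ : ℂ) ^ m / (m.factorial : ℂ)) * auxL G P (z + m) with hT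
  have hre : ∀ m : ℕ, ∀ z ∈ U, 1 < (z + ((m + N : ℕ) : ℂ)).re := by
    intro m z hz
    simp only [hU, mem_ofPred_eq] at hz
    simp only [add_re, natCast_re]; push_cast
    have : (0:ℝ) ≤ m := by positivity
    linarith
  have hbd : ∀ m : ℕ, ∀ z ∈ U, ‖T (m + N) z‖ ≤ |γ| ^ (m + N) / (m + N).factorial * M := by
    intro m z hz
    simp only [hT, norm_mul, norm_div, norm_pow, norm_neg, Complex.norm_real,
          Complex.norm_natCast, Real.norm_eq_abs]
    rw [auxL_eq G hG M hM P hP _ (one_pos.trans (hre m z hz))]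
    gcongr
    exact auxF_mellin_bd G M hM _ (hre m z hz)
  have hs : Summable fun m : ℕ => |γ| ^ (m + N) / (m + N).factorial * M :=
    ((summable_nat_add_iff N).2 (Real.summable_pow_div_factorial |γ|)).mul_right M
  have hd : DifferentiableOn ℂ (fun z => ∑' m : ℕ, T (m + N) z) U := by
    refine differentiableOn_tsum_of_summable_norm hs (fun m z hz => ?_) hUo hbd
    have h1 : DifferentiableAt ℂ (mellin (auxF G)) (z + ((m + N : ℕ) : ℂ)) :=
      auxF_diff G hG M hM _ (one_pos.trans (hre m z hz))
    have h2 : DifferentiableAt ℂ (fun z => ((-γ : ℂ) ^ (m + N) / ((m + N).factorial : ℂ)) *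
      mellin (auxF G) (z + ((m + N : ℕ) : ℂ))) z :=
      (DifferentiableAt.comp (g := mellin (auxF G)) (f := fun z : ℂ => z + ((m + N : ℕ) : ℂ)) z h1
        (by fun_prop)).const_mul _
    refine (h2.differentiableWithinAt).congr (fun y hy => ?_) ?_
    · simp only [hT]; rw [auxL_eq G hG M hM P hP _ (one_pos.trans (hre m y hy))]
    · simp only [hT]; rw [auxL_eq G hG M hM P hP _ (one_pos.trans (hre m z hz))]
  have htail : AnalyticAt ℂ (fun z => ∑' m : ℕ, T (m + N) z) w :=
    hd.analyticAt (hUo.mem_nhds hwU)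
  have heq : auxS G P γ =ᶠ[nhds w] fun z =>
      (∑ m ∈ Finset.range N, T m z) + ∑' m : ℕ, T (m + N) z := by
    filter_upwards [hUo.mem_nhds hwU] with z hz
    have : Summable fun m => T m z :=
      (summable_nat_add_iff N).1 (Summable.of_norm_bounded hs fun m => hbd m z hz)
    exact (this.sum_add_tsum_nat_add N).symm
  have hTm : ∀ m, MeromorphicAt (T m) w := by
    intro m
    have h1 := (auxL_ana G hG M hM P hP hper (w + m)).1
    have h2 : MeromorphicAt (fun z => auxL G P (z + m)) w :=
      MeromorphicAt.comp_analyticAt (f := auxL G P) (g := fun z : ℂ => z + m) h1 (by fun_prop)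
    exact (MeromorphicAt.const _ w).mul h2
  constructor
  · refine MeromorphicAt.congr ?_ (heq.symm.filter_mono nhdsWithin_le_nhds)
    exact (MeromorphicAt.fun_sum fun m _ => hTm m).add htail.meromorphicAt
  · intro hna
    by_contra hcon
    push Not at hcon
    apply hna
    refine AnalyticAt.congr ?_ heq.symm
    refine AnalyticAt.add (f := fun z => ∑ m ∈ Finset.range N, T m z) ?_ htail
    refine Finset.analyticAt_fun_sum _ fun m _ => ?_
    have h1 : AnalyticAt ℂ (auxL G P) (w + m) := by
      refine (auxL_ana G hG M hM P hP hper (w + m)).2 fun h => ?_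
      obtain ⟨n, hn⟩ := auxL_pole P hP _ h
      exact hcon m n (by rw [← hn]; ring)
    have h2 : AnalyticAt ℂ (fun z => auxL G P (z + m)) w :=
      AnalyticAt.comp (g := auxL G P) (f := fun z : ℂ => z + m) h1 (by fun_prop)
    exact analyticAt_const.mul h2

lemma auxF_cast_sum (d : ℕ) (β : Fin (d + 1) → ℝ) (G : Fin (d + 1) → ℝ → ℝ) (t : ℝ)
    (ht : t ∈ Ioo (0:ℝ) 1) :
    ∑ k : Fin (d + 1), (t : ℂ) ^ (-(β k) : ℂ) * auxF (G k) t =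
      ((∑ k : Fin (d + 1), t ^ (-(β k)) * G k (Real.log (1 / t)) : ℝ) : ℂ) := by
  push_cast
  refine Finset.sum_congr rfl fun k _ => ?_
  unfold auxF
  rw [indicator_of_mem ht, Complex.ofReal_cpow ht.1.le]
  push_cast
  rfl

/-- Lemma 2 of the paper (ExpBounds): a multi-term log-periodic expansion of
the partition function with stretched-exponentially small remainder yields a
meromorphic continuation of the Mellin transform to all of `ℂ`, with poles
contained in finitely many vertical towers
`β_k - m + 2πin/P_k`, `m ∈ ℕ`, `n ∈ ℤ`. -/
theorem stmt_17 (Z : ℝ → ℝ) (hZm : Measurable Z) (d : ℕ)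
    (β : Fin (d + 1) → ℝ) (hβanti : ∀ i j : Fin (d + 1), i < j → β j < β i)
    (hβ0 : 0 ≤ β (Fin.last d))
    (G : Fin (d + 1) → ℝ → ℝ) (hGc : ∀ k, Continuous (G k))
    (P : Fin (d + 1) → ℝ) (hP : ∀ k, 0 < P k)
    (hGper : ∀ k, Function.Periodic (G k) (P k))
    (M : ℝ) (hGbd : ∀ k, ∀ x : ℝ, |G k x| ≤ M)
    (C c α : ℝ) (hc : 0 < c) (hα : 0 < α)
    (hsmall : ∀ t ∈ Ioo (0 : ℝ) 1,
      |Z t - ∑ k : Fin (d + 1), t ^ (-(β k)) * G k (Real.log (1 / t))| ≤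
        C * Real.exp (-c * t ^ (-α)))
    (c₅ c₆ : ℝ) (hc₆ : 0 < c₆)
    (hlarge : ∀ t : ℝ, 1 ≤ t → |Z t| ≤ c₅ * Real.exp (-c₆ * t))
    (γ : ℝ) (hγ : -c₆ < γ) :
    ∃ g : ℂ → ℂ,
      MeromorphicOn g Set.univ ∧
      (∀ s : ℂ, β 0 < s.re →
        g s = ∫ t in Ioi (0 : ℝ),
          (t : ℂ) ^ (s - 1) * (Z t : ℂ) * (Real.exp (-γ * t) : ℂ)) ∧
      (∀ s : ℂ, ¬ AnalyticAt ℂ g s →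
        ∃ (k : Fin (d + 1)) (m : ℕ) (n : ℤ),
          s = (β k : ℂ) - m + 2 * Real.pi * Complex.I * n / P k) := by
  have hlast : 0 < c₆ + γ := by linarith
  have h_le : ∀ k, β k ≤ β 0 := by
    intro k
    rcases eq_or_ne k 0 with h | h
    · rw [h]
    · exact (hβanti 0 k (Fin.pos_of_ne_zero h)).le
  set h : ℝ → ℂ := fun t => ((Z t : ℂ) - ∑ k : Fin (d + 1), (t : ℂ) ^ (-(β k) : ℂ) * auxF (G k) t) *
    (Real.exp (-γ * t) : ℂ) with hh
  have hmeas : Measurable h := by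
    refine Measurable.mul (Measurable.sub (Complex.measurable_ofReal.comp hZm) ?_) (by fun_prop)
    refine Finset.measurable_fun_sum _ fun k _ => ?_
    exact (Complex.measurable_ofReal.pow_const _).mul (auxF_meas (G k) (hGc k))
  have hb0 : ∀ t ∈ Ioo (0:ℝ) 1, ‖h t‖ ≤ (|C| * Real.exp |γ|) * Real.exp (-c * t ^ (-α)) := by
    intro t ht
    simp only [hh]
    rw [auxF_cast_sum d β G t ht, ← Complex.ofReal_sub, norm_mul, Complex.norm_real,
      Complex.norm_real, Real.norm_eq_abs, Real.norm_of_nonneg (Real.exp_pos _).le]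
    have h1 : Real.exp (-γ * t) ≤ Real.exp |γ| := by
      apply Real.exp_le_exp.2
      nlinarith [neg_abs_le γ, abs_nonneg γ, ht.1, ht.2]
    have h2 := hsmall t ht
    have h3 : C * Real.exp (-c * t ^ (-α)) ≤ |C| * Real.exp (-c * t ^ (-α)) := by
      gcongr; exact le_abs_self C
    calc _ ≤ (|C| * Real.exp (-c * t ^ (-α))) * Real.exp |γ| := by
          gcongr; exact h2.trans h3
      _ = _ := by ring
  have hb1 : ∀ t : ℝ, 1 ≤ t → ‖h t‖ ≤ |c₅| * Real.exp (-(c₆ + γ) * t) := by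
    intro t ht
    have h0 : ∑ k : Fin (d + 1), (t : ℂ) ^ (-(β k) : ℂ) * auxF (G k) t = 0 :=
      Finset.sum_eq_zero fun k _ => by rw [auxF_zero _ t ht, mul_zero]
    simp only [hh]
    rw [h0, sub_zero, norm_mul, Complex.norm_real,
      Complex.norm_real, Real.norm_eq_abs, Real.norm_of_nonneg (Real.exp_pos _).le]
    have h3 : c₅ * Real.exp (-c₆ * t) ≤ |c₅| * Real.exp (-c₆ * t) := by
      gcongr; exact le_abs_self c₅
    calc _ ≤ (|c₅| * Real.exp (-c₆ * t)) * Real.exp (-γ * t) := by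
          gcongr; exact (hlarge t ht).trans h3
      _ = _ := by rw [mul_assoc, ← Real.exp_add]; ring_nf
  have hloc : LocallyIntegrableOn h (Ioi (0:ℝ)) := by
    refine aux_locInt h hmeas (|C| * Real.exp |γ| + |c₅|) fun t ht => ?_
    rcases lt_or_ge t 1 with h1 | h1
    · have e1 : Real.exp (-c * t ^ (-α)) ≤ 1 := by
        rw [Real.exp_le_one_iff]
        have := mul_pos hc (Real.rpow_pos_of_pos ht (-α))
        linarith
      have := hb0 t ⟨ht, h1⟩
      have e2 : |C| * Real.exp |γ| * Real.exp (-c * t ^ (-α)) ≤ |C| * Real.exp |γ| * 1 := by gcongr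
      linarith [abs_nonneg c₅]
    · have e1 : Real.exp (-(c₆ + γ) * t) ≤ 1 := by
        rw [Real.exp_le_one_iff]; nlinarith
      have := hb1 t h1
      have e2 : |c₅| * Real.exp (-(c₆ + γ) * t) ≤ |c₅| * 1 := by gcongr
      have e3 : 0 ≤ |C| * Real.exp |γ| := by positivity
      linarith
  have htop : ∀ a : ℝ, h =O[Filter.atTop] (fun t : ℝ => t ^ (-a)) := by
    intro a
    refine Asymptotics.IsBigO.trans ?_ (isLittleO_exp_neg_mul_rpow_atTop hlast (-a)).isBigO
    refine Asymptotics.IsBigO.of_bound |c₅| ?_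
    filter_upwards [Filter.eventually_ge_atTop (1:ℝ)] with t ht
    rw [Real.norm_of_nonneg (Real.exp_pos _).le]
    exact hb1 t ht
  have hbot : ∀ b : ℝ, h =O[nhdsWithin 0 (Ioi 0)] (fun t : ℝ => t ^ (-b)) := by
    intro b
    have h1 := ((isLittleO_exp_neg_mul_rpow_atTop hc (b / α)).comp_tendsto
      (tendsto_rpow_neg_nhdsGT_zero (neg_lt_zero.2 hα))).isBigO
    have h2 : h =O[nhdsWithin 0 (Ioi 0)]
        ((fun x : ℝ => Real.exp (-c * x)) ∘ fun x : ℝ => x ^ (-α)) := by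
      refine Asymptotics.IsBigO.of_bound (|C| * Real.exp |γ|) ?_
      filter_upwards [Ioo_mem_nhdsGT (one_pos : (0:ℝ) < 1)] with t ht
      simp only [Function.comp]
      rw [Real.norm_of_nonneg (Real.exp_pos _).le]
      exact hb0 t ht
    refine (h2.trans h1).congr' Filter.EventuallyEq.rfl ?_
    filter_upwards [self_mem_nhdsWithin] with t ht
    simp only [Function.comp]
    rw [← Real.rpow_mul (le_of_lt ht)]
    congr 1
    field_simp
  have hconv : ∀ s : ℂ, MellinConvergent h s := fun s =>
    mellinConvergent_of_isBigO_rpow hloc (htop (s.re + 1)) (lt_add_one _) (hbot (s.re - 1))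
      (sub_one_lt _)
  have hdiff : Differentiable ℂ (mellin h) := fun s =>
    mellin_differentiableAt_of_isBigO_rpow hloc (htop (s.re + 1)) (lt_add_one _) (hbot (s.re - 1))
      (sub_one_lt _)
  refine ⟨fun s => mellin h s + ∑ k : Fin (d + 1), auxS (G k) (P k) γ (s - β k), ?_, ?_, ?_⟩
  · intro s _
    refine (hdiff.analyticAt s).meromorphicAt.add (MeromorphicAt.fun_sum fun k _ => ?_)
    exact MeromorphicAt.comp_analyticAt (f := auxS (G k) (P k) γ) (g := fun z : ℂ => z - β k)
      (auxS_mero (G k) (hGc k) M (hGbd k) (P k) γ (hP k) (hGper k) _).1 (by fun_prop)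
  · intro s hs
    have hk : ∀ k, 0 < (s - (β k : ℂ)).re := by
      intro k
      have := h_le k
      simp only [sub_re, ofReal_re]; linarith
    have hS := fun k => auxS_mellin (G k) (hGc k) M (hGbd k) (P k) γ (hP k) _ (hk k)
    have hS1 : ∀ k, MellinConvergent (fun t : ℝ => (t : ℂ) ^ (-(β k) : ℂ) •
        (auxF (G k) t * (Real.exp (-γ * t) : ℂ))) s := fun k =>
      MellinConvergent.cpow_smul.2 (by rw [← sub_eq_add_neg]; exact (hS k).1)
    have hS2 : ∀ k, auxS (G k) (P k) γ (s - β k) = mellin (fun t : ℝ => (t : ℂ) ^ (-(β k) : ℂ) •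
        (auxF (G k) t * (Real.exp (-γ * t) : ℂ))) s := fun k => by
      rw [mellin_cpow_smul, ← sub_eq_add_neg]; exact (hS k).2
    simp only [hS2, mellin]
    rw [← integral_finset_sum _ (fun k _ => hS1 k),
      ← integral_add (hconv s) (integrable_finset_sum _ (fun k _ => hS1 k))]
    refine setIntegral_congr_fun measurableSet_Ioi fun t ht => ?_
    simp only [hh, smul_eq_mul]
    rw [← Finset.mul_sum]
    simp only [← mul_assoc]
    rw [← Finset.sum_mul]
    ring
  · intro s hs
    by_contra hcon
    push Not at hcon
    apply hs
    refine AnalyticAt.add (f := mellin h) (hdiff.analyticAt s)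
      (Finset.analyticAt_fun_sum _ fun k _ => ?_)
    refine AnalyticAt.comp (g := auxS (G k) (P k) γ) (f := fun z : ℂ => z - β k) ?_ (by fun_prop)
    by_contra hna
    obtain ⟨m, n, hmn⟩ :=
      (auxS_mero (G k) (hGc k) M (hGbd k) (P k) γ (hP k) (hGper k) _).2 hna
    exact hcon k m n (by linear_combination hmn)
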